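/- Let G be a finite connected simple graph of order n ≥ 3. Then γ_qtR(G) = 4 if and only if γ(G) = 2 and γ_t(G) = 2. -/

import Mathlib

/-- A Roman dominating function: labels in {0,1,2}, and every vertex labeled 0
has a neighbor labeled 2. -/
def IsRDF {V : Type*} (G : SimpleGraph V) (f : V → ℕ) : Prop :=
  (∀ v, f v ≤ 2) ∧ ∀ u, f u = 0 → ∃ v, G.Adj u v ∧ f v = 2

/-- A quasi-total Roman dominating function: an RDF such that every vertex labeled 2
has a neighbor with positive label. -/
def IsQTRDF {V : Type*} (G : SimpleGraph V) (f : V → ℕ) : Prop :=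
  IsRDF G f ∧ ∀ x, f x = 2 → ∃ y, G.Adj x y ∧ 1 ≤ f y

/-- A total Roman dominating function: an RDF such that every vertex with positive label
has a neighbor with positive label. -/
def IsTRDF {V : Type*} (G : SimpleGraph V) (f : V → ℕ) : Prop :=
  IsRDF G f ∧ ∀ v, 1 ≤ f v → ∃ w, G.Adj v w ∧ 1 ≤ f w

/-- The Roman domination number. -/
noncomputable def gammaR {V : Type*} [Fintype V] (G : SimpleGraph V) : ℕ :=
  sInf {w | ∃ f : V → ℕ, IsRDF G f ∧ ∑ v, f v = w}

/-- The quasi-total Roman domination number. -/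
noncomputable def gammaQTR {V : Type*} [Fintype V] (G : SimpleGraph V) : ℕ :=
  sInf {w | ∃ f : V → ℕ, IsQTRDF G f ∧ ∑ v, f v = w}

/-- The total Roman domination number. -/
noncomputable def gammaTR {V : Type*} [Fintype V] (G : SimpleGraph V) : ℕ :=
  sInf {w | ∃ f : V → ℕ, IsTRDF G f ∧ ∑ v, f v = w}

/-- A dominating set: every vertex outside it has a neighbor in it. -/
def IsDomSet {V : Type*} (G : SimpleGraph V) (D : Finset V) : Prop :=
  ∀ v ∉ D, ∃ u ∈ D, G.Adj v u

/-- The domination number. -/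
noncomputable def gammaDom {V : Type*} [Fintype V] (G : SimpleGraph V) : ℕ :=
  sInf {n | ∃ D : Finset V, IsDomSet G D ∧ D.card = n}

/-- A total dominating set: every vertex has a neighbor in it. -/
def IsTotalDomSet {V : Type*} (G : SimpleGraph V) (D : Finset V) : Prop :=
  ∀ v, ∃ u ∈ D, G.Adj v u

/-- The total domination number. -/
noncomputable def gammaT {V : Type*} [Fintype V] (G : SimpleGraph V) : ℕ :=
  sInf {n | ∃ D : Finset V, IsTotalDomSet G D ∧ D.card = n}

/-- A packing: a set of vertices whose closed neighborhoods are pairwise disjoint. -/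
def IsPacking {V : Type*} (G : SimpleGraph V) (B : Finset V) : Prop :=
  ∀ u ∈ B, ∀ v ∈ B, u ≠ v →
    ∀ w, ¬ ((w = u ∨ G.Adj u w) ∧ (w = v ∨ G.Adj v w))

/-- The packing number. -/
noncomputable def packingNumber {V : Type*} [Fintype V] (G : SimpleGraph V) : ℕ :=
  sSup {n | ∃ B : Finset V, IsPacking G B ∧ B.card = n}

/-- A vertex adjacent to all other vertices exists. -/
def HasUniversalVertex {V : Type*} (G : SimpleGraph V) : Prop :=
  ∃ v, ∀ u, u ≠ v → G.Adj u v

/-- An edge whose endpoints form a total dominating set exists. -/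
def HasTotalDomEdge {V : Type*} (G : SimpleGraph V) : Prop :=
  ∃ x y, G.Adj x y ∧ ∀ u, G.Adj u x ∨ G.Adj u y

lemma list_sum_le_sum_univ {V : Type*} [Fintype V] (f : V → ℕ) (l : List V) (hl : l.Nodup) :
    (l.map f).sum ≤ ∑ v, f v := by
  classical
  rw [← List.sum_toFinset f hl]
  exact Finset.sum_le_sum_of_subset (Finset.subset_univ _)

lemma exists_adj_adj_ne {V : Type*} [Fintype V] {G : SimpleGraph V}
    (hconn : G.Connected) (hcard : 3 ≤ Fintype.card V) :
    ∃ v a c, a ≠ c ∧ G.Adj v a ∧ G.Adj v c := by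
  classical
  have : Nontrivial V := Fintype.one_lt_card_iff_nontrivial.1 (by omega)
  obtain ⟨a⟩ := hconn.nonempty
  obtain ⟨b, hab⟩ := hconn.preconnected.exists_adj_of_nontrivial a
  obtain ⟨c, hc⟩ : ∃ c, c ∉ ({a, b} : Finset V) := by
    by_contra! h
    have h2 := Finset.card_le_card (fun x _ => h x : Finset.univ ⊆ ({a, b} : Finset V))
    have h3 := Finset.card_le_two (a := a) (b := b)
    rw [Finset.card_univ] at h2
    omega
  obtain ⟨p⟩ := hconn.preconnected a c
  obtain ⟨d, -, h1, h2⟩ := p.exists_boundary_dart (({a, b} : Finset V) : Set V) (by simp)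
    (by simpa using hc)
  have hd := d.adj
  simp only [Finset.coe_insert, Finset.coe_singleton, Set.mem_insert_iff,
    Set.mem_singleton_iff, not_or] at h1 h2
  rcases h1 with h1 | h1
  · exact ⟨a, b, d.snd, Ne.symm h2.2, hab, h1 ▸ hd⟩
  · exact ⟨b, a, d.snd, Ne.symm h2.1, hab.symm, h1 ▸ hd⟩

lemma hasUniversalVertex_or_hasTotalDomEdge {V : Type*} {G : SimpleGraph V} [Nontrivial V]
    (hconn : G.Connected) (v : V)
    (h : ∀ b c, b ≠ v → c ≠ v → ¬ G.Adj b v → ¬ G.Adj c v → b = c) :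
    HasUniversalVertex G ∨ HasTotalDomEdge G := by
  by_cases hv : ∀ u, u ≠ v → G.Adj u v
  · exact Or.inl ⟨v, hv⟩
  push Not at hv
  obtain ⟨b, hbv, hb⟩ := hv
  obtain ⟨w, hbw⟩ := hconn.preconnected.exists_adj_of_nontrivial b
  have hwv : w ≠ v := fun e => hb (e ▸ hbw)
  have hw : G.Adj w v := by
    by_contra hw
    exact hbw.ne (h b w hbv hwv hb hw)
  refine Or.inr ⟨v, w, hw.symm, fun u => ?_⟩
  by_cases huv : u = v
  · exact Or.inr (huv ▸ hw.symm)
  by_cases hu : G.Adj u v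
  · exact Or.inl hu
  · exact Or.inr (h b u hbv huv hb hu ▸ hbw)

lemma exists_isQTRDF_sum_eq_gammaQTR {V : Type*} [Fintype V] (G : SimpleGraph V) :
    ∃ f : V → ℕ, IsQTRDF G f ∧ ∑ v, f v = gammaQTR G :=
  Nat.sInf_mem (s := {w | ∃ f : V → ℕ, IsQTRDF G f ∧ ∑ v, f v = w})
    ⟨_, fun _ => 1, ⟨⟨by simp, by simp⟩, by simp⟩, rfl⟩

lemma gammaQTR_le_three_iff {V : Type*} [Fintype V] {G : SimpleGraph V}
    (hconn : G.Connected) (hcard : 3 ≤ Fintype.card V) :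
    gammaQTR G ≤ 3 ↔ HasUniversalVertex G := by
  classical
  constructor
  · intro h
    obtain ⟨f, ⟨⟨-, h0⟩, h2⟩, hs⟩ := exists_isQTRDF_sum_eq_gammaQTR G
    have hl := list_sum_le_sum_univ f
    by_cases hv : ∃ v, f v = 2
    · obtain ⟨v, hv⟩ := hv
      obtain ⟨y, hvy, hy⟩ := h2 v hv
      refine ⟨v, fun u huv => ?_⟩
      by_contra hu
      have huy : u ≠ y := fun e => hu (e ▸ hvy.symm)
      rcases Nat.eq_zero_or_pos (f u) with hu0 | hu0
      · obtain ⟨w, huw, hw⟩ := h0 u hu0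
        have hwv : w ≠ v := fun e => hu (e ▸ huw)
        have := hl [v, w] (by simp [hwv.symm])
        simp at this
        omega
      · have := hl [v, y, u] (by simp [hvy.ne, huv.symm, huy.symm])
        simp at this
        omega
    · push Not at hv
      have hpos : ∀ u, 1 ≤ f u := fun u => Nat.one_le_iff_ne_zero.2 fun hu =>
        let ⟨w, _, hw⟩ := h0 u hu
        hv w hw
      obtain ⟨v, a, c, hac, hva, hvc⟩ := exists_adj_adj_ne hconn hcard
      refine ⟨v, fun u huv => ?_⟩
      by_contra hu
      have hua : u ≠ a := fun e => hu (e ▸ hva.symm)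
      have huc : u ≠ c := fun e => hu (e ▸ hvc.symm)
      have := hl [v, a, c, u] (by simp [hva.ne, hvc.ne, huv.symm, hac, hua.symm, huc.symm])
      simp at this
      have := hpos v
      have := hpos a
      have := hpos c
      have := hpos u
      omega
  · rintro ⟨v, hv⟩
    have : Nontrivial V := Fintype.one_lt_card_iff_nontrivial.1 (by omega)
    obtain ⟨y, hy⟩ := exists_ne v
    refine Nat.sInf_le ⟨fun u => if u = v then 2 else if u = y then 1 else 0,
      ⟨⟨fun u => ?_, fun u hu => ⟨v, hv u ?_, by simp⟩⟩, fun x hx => ?_⟩, ?_⟩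
    · dsimp only
      split_ifs <;> omega
    · rintro rfl
      simp at hu
    · have hxv : x = v := by
        by_contra hxv
        simp only [hxv, if_false] at hx
        split_ifs at hx; omega
      exact ⟨y, hxv ▸ (hv y hy).symm, by simp [hy]⟩
    · have : ∀ u, (if u = v then 2 else if u = y then 1 else 0) =
          (if u = v then 2 else 0) + (if u = y then 1 else 0) := by
        intro u
        split_ifs with h1 h2 <;> first | rfl | exact absurd (h2.symm.trans h1) hy
      simp [this, Finset.sum_add_distrib]

lemma gammaQTR_le_four_of_hasTotalDomEdge {V : Type*} [Fintype V] {G : SimpleGraph V}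
    (h : HasTotalDomEdge G) : gammaQTR G ≤ 4 := by
  classical
  obtain ⟨x, y, hxy, h⟩ := h
  refine Nat.sInf_le ⟨fun u => if u = x then 2 else if u = y then 2 else 0,
    ⟨⟨fun u => ?_, fun u hu => ?_⟩, fun z hz => ?_⟩, ?_⟩
  · dsimp only
    split_ifs <;> omega
  · rcases h u with h | h
    · exact ⟨x, h, by simp⟩
    · exact ⟨y, h, by simp⟩
  · rcases h z with h | h
    · exact ⟨x, h, by simp⟩
    · exact ⟨y, h, by simp [hxy.ne.symm]⟩
  · have : ∀ u, (if u = x then 2 else if u = y then 2 else 0) =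
        (if u = x then 2 else 0) + (if u = y then 2 else 0) := by
      intro u
      split_ifs with h1 h2 <;> first | rfl | exact absurd (h1.symm.trans h2) hxy.ne
    simp [this, Finset.sum_add_distrib]

lemma hasUniversalVertex_or_hasTotalDomEdge_of_gammaQTR_le_four {V : Type*} [Fintype V]
    {G : SimpleGraph V} (hconn : G.Connected) (hcard : 3 ≤ Fintype.card V)
    (h : gammaQTR G ≤ 4) : HasUniversalVertex G ∨ HasTotalDomEdge G := by
  have : Nontrivial V := Fintype.one_lt_card_iff_nontrivial.1 (by omega)
  obtain ⟨f, ⟨⟨hle, h0⟩, h2⟩, hs⟩ := exists_isQTRDF_sum_eq_gammaQTR G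
  have hl := list_sum_le_sum_univ f
  by_cases hv : ∃ v, f v = 2
  · obtain ⟨v, hv⟩ := hv
    obtain ⟨y, hvy, hy⟩ := h2 v hv
    by_cases hy2 : f y = 2
    · refine Or.inr ⟨v, y, hvy, fun u => ?_⟩
      by_cases huv : u = v
      · exact Or.inr (huv ▸ hvy)
      by_cases huy : u = y
      · exact Or.inl (huy ▸ hvy.symm)
      have := hl [v, y, u] (by simp [hvy.ne, Ne.symm huv, Ne.symm huy])
      simp at this
      obtain ⟨w, huw, hw⟩ := h0 u (by omega)
      by_contra! hu
      have hwv : w ≠ v := fun e => hu.1 (e ▸ huw)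
      have hwy : w ≠ y := fun e => hu.2 (e ▸ huw)
      have := hl [v, y, w] (by simp [hvy.ne, hwv.symm, hwy.symm])
      simp at this
      omega
    · have hpos : ∀ u, ¬ G.Adj u v → 1 ≤ f u := fun u hu => by
        by_contra hu0
        obtain ⟨w, huw, hw⟩ := h0 u (by omega)
        have hwv : w ≠ v := fun e => hu (e ▸ huw)
        have hwy : w ≠ y := fun e => hy2 (e ▸ hw)
        have := hl [v, y, w] (by simp [hvy.ne, hwv.symm, hwy.symm])
        simp at this
        omega
      refine hasUniversalVertex_or_hasTotalDomEdge hconn v fun b c hbv hcv hb hc => ?_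
      by_contra hbc
      have hby : b ≠ y := fun e => hb (e ▸ hvy.symm)
      have hcy : c ≠ y := fun e => hc (e ▸ hvy.symm)
      have := hl [v, y, b, c]
        (by simp [hvy.ne, hbv.symm, hcv.symm, hby.symm, hcy.symm, hbc])
      simp at this
      have := hpos b hb
      have := hpos c hc
      omega
  · push Not at hv
    have hpos : ∀ u, 1 ≤ f u := fun u => Nat.one_le_iff_ne_zero.2 fun hu =>
      let ⟨w, _, hw⟩ := h0 u hu
      hv w hw
    obtain ⟨v, x, y, hxy, hvx, hvy⟩ := exists_adj_adj_ne hconn hcard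
    refine hasUniversalVertex_or_hasTotalDomEdge hconn v fun b c hbv hcv hb hc => ?_
    by_contra hbc
    have hbx : b ≠ x := fun e => hb (e ▸ hvx.symm)
    have hcx : c ≠ x := fun e => hc (e ▸ hvx.symm)
    have hby : b ≠ y := fun e => hb (e ▸ hvy.symm)
    have hcy : c ≠ y := fun e => hc (e ▸ hvy.symm)
    have := hl [v, x, y, b, c] (by
      simp [hvx.ne, hvy.ne, hxy, hbv.symm, hcv.symm, hbx.symm, hcx.symm, hby.symm, hcy.symm, hbc])
    simp at this
    have := hpos v
    have := hpos x
    have := hpos y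
    have := hpos b
    have := hpos c
    omega

lemma gammaDom_le_one_iff {V : Type*} [Fintype V] [Nonempty V] (G : SimpleGraph V) :
    gammaDom G ≤ 1 ↔ HasUniversalVertex G := by
  constructor
  · intro h
    obtain ⟨D, hD, hc⟩ := Nat.sInf_mem (s := {n | ∃ D : Finset V, IsDomSet G D ∧ D.card = n})
      ⟨_, Finset.univ, fun v hv => absurd (Finset.mem_univ v) hv, rfl⟩
    have hc1 : D.card ≤ 1 := hc.trans_le h
    obtain ⟨v, hv⟩ := Finset.card_le_one_iff_subset_singleton.1 hc1
    refine ⟨v, fun u huv => ?_⟩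
    obtain ⟨w, hw, huw⟩ := hD u fun hu => huv (Finset.mem_singleton.1 (hv hu))
    exact Finset.mem_singleton.1 (hv hw) ▸ huw
  · rintro ⟨v, hv⟩
    exact Nat.sInf_le ⟨{v}, fun u hu => ⟨v, by simp, hv u (by simpa using hu)⟩, by simp⟩

lemma gammaDom_le_two_of_hasTotalDomEdge {V : Type*} [Fintype V] {G : SimpleGraph V}
    (h : HasTotalDomEdge G) : gammaDom G ≤ 2 := by
  classical
  obtain ⟨x, y, hxy, h⟩ := h
  exact Nat.sInf_le ⟨{x, y}, fun u _ => by simpa using h u, Finset.card_pair hxy.ne⟩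

lemma gammaT_eq_two_iff {V : Type*} [Fintype V] [Nonempty V] (G : SimpleGraph V) :
    gammaT G = 2 ↔ HasTotalDomEdge G := by
  classical
  constructor
  · intro h
    obtain ⟨D, hD, hc⟩ := Nat.sInf_mem (Nat.nonempty_of_sInf_eq_succ h)
    obtain ⟨x, y, -, rfl⟩ := Finset.card_eq_two.1 (hc.trans h)
    have hD' : ∀ u, G.Adj u x ∨ G.Adj u y := fun u => by simpa using hD u
    exact ⟨x, y, (hD' x).resolve_left (G.irrefl), hD'⟩
  · rintro ⟨x, y, hxy, h⟩
    have hmem : 2 ∈ {n | ∃ D : Finset V, IsTotalDomSet G D ∧ D.card = n} :=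
      ⟨{x, y}, fun u => by simpa using h u, Finset.card_pair hxy.ne⟩
    refine le_antisymm (Nat.sInf_le hmem) ?_
    obtain ⟨D, hD, hc⟩ := Nat.sInf_mem ⟨2, hmem⟩
    obtain ⟨u, hu, -⟩ := hD x
    obtain ⟨w, hw, huw⟩ := hD u
    exact (Finset.one_lt_card.2 ⟨u, hu, w, hw, huw.ne⟩).trans_eq hc

theorem stmt14 {V : Type*} [Fintype V] (G : SimpleGraph V)
    (hconn : G.Connected) (hcard : 3 ≤ Fintype.card V) :
    gammaQTR G = 4 ↔ (gammaDom G = 2 ∧ gammaT G = 2) := by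
  have := hconn.nonempty
  have h3 := gammaQTR_le_three_iff hconn hcard
  have hD := gammaDom_le_one_iff G
  rw [gammaT_eq_two_iff]
  constructor
  · intro h
    have hU : ¬ HasUniversalVertex G := fun hU => by
      have := h3.2 hU
      omega
    have hE := (hasUniversalVertex_or_hasTotalDomEdge_of_gammaQTR_le_four hconn hcard
      h.le).resolve_left hU
    have := gammaDom_le_two_of_hasTotalDomEdge hE
    have := mt hD.1 hU
    exact ⟨by omega, hE⟩
  · rintro ⟨h, hE⟩
    have hU : ¬ HasUniversalVertex G := fun hU => by
      have := hD.2 hU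
      omega
    have := gammaQTR_le_four_of_hasTotalDomEdge hE
    have := mt h3.1 hU
    omega
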